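/- (Derivation on the size of the blocks) Let t, m, s, v be positive integers with v ≥ 2, s ≤ t, and t ≤ ms. Then OCAN(t,m,s,v) ≤ ⌊OCAN(t+1,m,s+1,v)/v⌋. -/

import Mathlib

/-- An anti-ideal of the NRT poset `[m·s]`, whose elements are pairs
`(i, a) : Fin m × Fin s` (block `i`, position `a` within the block, positions
within a block forming a chain): an anti-ideal is an up-closed subset. -/
def IsAntiIdeal (m s : ℕ) (J : Finset (Fin m × Fin s)) : Prop :=
  ∀ i : Fin m, ∀ a b : Fin s, a ≤ b → (i, a) ∈ J → (i, b) ∈ J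

/-- Existence of an ordered covering array `OCA_λ(N; t, m, s, v)`:
an `N × ms` array over an alphabet of size `v`, columns indexed by the NRT poset
`[m·s]`, such that for every anti-ideal `J` of size `t`, every `t`-tuple appears
at least `lam` times as a row of the subarray given by the columns in `J`. -/
def IsOCA (lam N t m s v : ℕ) : Prop :=
  ∃ A : Fin N → Fin m × Fin s → Fin v,
    ∀ J : Finset (Fin m × Fin s), IsAntiIdeal m s J → J.card = t →
      ∀ f : Fin m × Fin s → Fin v,
        lam ≤ (Finset.univ.filter (fun r : Fin N => ∀ c ∈ J, A r c = f c)).card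

/-- The ordered covering array number `OCAN_λ(t, m, s, v)`. -/
noncomputable def OCAN (lam t m s v : ℕ) : ℕ := sInf {N | IsOCA lam N t m s v}

/-- The array of all words is an ordered covering array, so ordered covering arrays exist. -/
lemma exists_isOCA_one (t m s v : ℕ) : ∃ N, IsOCA 1 N t m s v := by
  classical
  refine ⟨Fintype.card (Fin m × Fin s → Fin v), (Fintype.equivFin _).symm, fun J _ _ f => ?_⟩
  exact Finset.card_pos.2 ⟨Fintype.equivFin _ f, by simp⟩

/-- An ordered covering array attaining the ordered covering array number. -/
lemma isOCA_OCAN_one (t m s v : ℕ) : IsOCA 1 (OCAN 1 t m s v) t m s v :=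
  Nat.sInf_mem (s := {N | IsOCA 1 N t m s v}) (exists_isOCA_one t m s v)

/-- Embedding of `[m·s]` into `[m·(s+1)]` which omits the top element of the block `i₀` and the
bottom element of every other block. -/
def blockEmb (m s : ℕ) (i₀ : Fin m) : Fin m × Fin s ↪ Fin m × Fin (s + 1) where
  toFun c := (c.1, if c.1 = i₀ then c.2.castSucc else c.2.succ)
  inj' := by
    rintro ⟨i, a⟩ ⟨j, b⟩ h
    simp only [Prod.mk.injEq] at h
    obtain ⟨rfl, h⟩ := h
    split_ifs at h <;> simp_all

lemma blockEmb_apply {m s : ℕ} (i₀ : Fin m) (c : Fin m × Fin s) :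
    blockEmb m s i₀ c = (c.1, if c.1 = i₀ then c.2.castSucc else c.2.succ) := rfl

lemma blockEmb_ne_last {m s : ℕ} (i₀ : Fin m) (c : Fin m × Fin s) :
    blockEmb m s i₀ c ≠ (i₀, Fin.last s) := by
  intro h
  simp only [blockEmb_apply, Prod.mk.injEq] at h
  obtain ⟨h₁, h₂⟩ := h
  rw [if_pos h₁] at h₂
  exact Fin.castSucc_ne_last _ h₂

/-- Adding the top of the block `i₀` to the image of an anti-ideal gives an anti-ideal. -/
lemma IsAntiIdeal.insert_map_blockEmb {m s : ℕ} {J : Finset (Fin m × Fin s)}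
    (hJ : IsAntiIdeal m s J) (i₀ : Fin m) :
    IsAntiIdeal m (s + 1) (insert (i₀, Fin.last s) (J.map (blockEmb m s i₀))) := by
  intro i a b hab h
  rw [Finset.mem_insert, Finset.mem_map] at h ⊢
  rcases h with h | ⟨⟨j, c⟩, hc, h⟩
  · obtain ⟨rfl, rfl⟩ := Prod.mk.inj h
    exact Or.inl (by rw [Fin.last_le_iff.1 hab])
  · simp only [blockEmb_apply, Prod.mk.injEq] at h
    obtain ⟨rfl, rfl⟩ := h
    by_cases hj : j = i₀
    · rw [if_pos hj] at hab
      induction b using Fin.lastCases with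
      | last => exact Or.inl (by rw [hj])
      | cast b =>
        exact Or.inr ⟨(j, b), hJ j c b (Fin.castSucc_le_castSucc_iff.1 hab) hc,
          by simp [blockEmb_apply, hj]⟩
    · rw [if_neg hj] at hab
      induction b using Fin.cases with
      | zero => simp at hab
      | succ b =>
        exact Or.inr ⟨(j, b), hJ j c b (Fin.succ_le_succ_iff.1 hab) hc,
          by simp [blockEmb_apply, hj]⟩

/-- The rows of an ordered covering array with a fixed, least frequent symbol in the top column of
one block form an ordered covering array of smaller strength. -/
lemma IsOCA.exists_le_div {N t m s v : ℕ} (hA : IsOCA 1 N (t + 1) m (s + 1) v)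
    (hm : 1 ≤ m) (hv : 1 ≤ v) : ∃ n ≤ N / v, IsOCA 1 n t m s v := by
  classical
  obtain ⟨A, hA⟩ := hA
  let i₀ : Fin m := ⟨0, hm⟩
  obtain ⟨x, hx⟩ := Fintype.exists_card_fiber_lt_of_card_lt_mul
    (f := fun r => A r (i₀, Fin.last s)) (n := N / v + 1)
    (by simpa using Nat.lt_mul_div_succ N hv)
  let R : Finset (Fin N) := Finset.univ.filter fun r => A r (i₀, Fin.last s) = x
  refine ⟨R.card, Nat.lt_succ_iff.1 hx,
    fun k c => A (R.equivFin.symm k) (blockEmb m s i₀ c), fun J hJ hcard f => ?_⟩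
  have htop : (i₀, Fin.last s) ∉ J.map (blockEmb m s i₀) := by
    rw [Finset.mem_map]
    rintro ⟨c, -, hc⟩
    exact blockEmb_ne_last i₀ c hc
  obtain ⟨r, hr⟩ := Finset.card_pos.1 <| hA _ (hJ.insert_map_blockEmb i₀)
    (by rw [Finset.card_insert_of_notMem htop, Finset.card_map, hcard])
    (Function.extend (blockEmb m s i₀) f fun _ => x)
  have hr := (Finset.mem_filter.1 hr).2
  have hrR : r ∈ R := by
    refine Finset.mem_filter.2 ⟨Finset.mem_univ _, ?_⟩
    rw [hr _ (Finset.mem_insert_self _ _), Function.extend_apply']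
    rintro ⟨c, hc⟩
    exact blockEmb_ne_last i₀ c hc
  refine Finset.card_pos.2 ⟨R.equivFin ⟨r, hrR⟩, ?_⟩
  refine Finset.mem_filter.2 ⟨Finset.mem_univ _, fun c hc => ?_⟩
  beta_reduce
  rw [Equiv.symm_apply_apply, hr _ (Finset.mem_insert_of_mem (Finset.mem_map_of_mem _ hc)),
    (blockEmb m s i₀).injective.extend_apply]

/-- Derivation on the size of the blocks:
`OCAN(t,m,s,v) ≤ ⌊OCAN(t+1,m,s+1,v)/v⌋`. -/
theorem stmt_8 (t m s v : ℕ) (ht : 1 ≤ t) (hm : 1 ≤ m) (hs : 1 ≤ s)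
    (hv : 2 ≤ v) (hst : s ≤ t) (htm : t ≤ m * s) :
    OCAN 1 t m s v ≤ OCAN 1 (t + 1) m (s + 1) v / v := by
  obtain ⟨n, hn, hB⟩ := (isOCA_OCAN_one (t + 1) m (s + 1) v).exists_le_div hm (by omega)
  exact (Nat.sInf_le hB).trans hn
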